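/- arXiv:1711.00175 — 2 statements merged into one kernel-verified Lean document; each statement's English description precedes it below -/
import Mathlib

section
/- Let n ≥ 2 and let 1 ≤ s_1 < s_2 < … < s_k < n be integers. Then the number of spanning trees of the circulant graph C_{2n}(s_1,…,s_k,n) equals (1/(2n)) ∏_{j=1}^{2n−1} ( L(ε_{2n}^j) − (−1)^j ), where ε_{2n} = e^{πi/n} and L(z) = 2k + 1 − ∑_{j=1}^{k}(z^{s_j} + z^{−s_j}). -/
open Polynomial Complex Finset
open scoped Classical

/-- The circulant graph `C_n(s 0, …, s (k-1))` on vertex set `ZMod n`: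
`i` is adjacent to `i ± s j (mod n)` for each `j`. -/
def circulant (n : ℕ) {k : ℕ} (s : Fin k → ℕ) : SimpleGraph (ZMod n) :=
  SimpleGraph.circulantGraph {x : ZMod n | ∃ j : Fin k, x = (s j : ZMod n)}

/-- The odd-valency circulant graph `C_{2n}(s 0, …, s (k-1), n)` on vertex set `ZMod (2n)`:
`i` is adjacent to `i ± s j (mod 2n)` for each `j`, and to `i + n (mod 2n)`. -/
def circulantOdd (n : ℕ) {k : ℕ} (s : Fin k → ℕ) : SimpleGraph (ZMod (2 * n)) :=
  SimpleGraph.circulantGraph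
    ({x : ZMod (2 * n) | ∃ j : Fin k, x = (s j : ZMod (2 * n))} ∪ {(n : ZMod (2 * n))})

/-- The number of spanning trees of `G`: the number of subgraphs of `G` (on the same
vertex set) that are trees. -/
noncomputable def numSpanningTrees {V : Type*} (G : SimpleGraph V) : ℕ :=
  Set.ncard {H : SimpleGraph V | H ≤ G ∧ H.IsTree}

/-- The matrix `1 - P`, where `P` is the adjacency matrix of the functional graph of `f` with the
outgoing arrow of the root `r` removed. -/
def parentMatrix {V : Type*} [DecidableEq V] (R : Type*) [Ring R] (r : V) (f : V → V) :
    Matrix V V R :=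
  Matrix.of fun i => if i = r then Pi.single r 1 else Pi.single i 1 - Pi.single (f i) 1

/-- The graph joining each vertex to its image under `f`. -/
def parentGraph {V : Type*} (f : V → V) : SimpleGraph V :=
  SimpleGraph.fromRel fun i j => f i = j

section Determinants

variable {V : Type*} [Fintype V] [DecidableEq V] {R : Type*} [CommRing R]

lemma Matrix.det_one_sub_of_isNilpotent [IsDomain R] {P : Matrix V V R} (hP : IsNilpotent P) :
    (1 - P).det = 1 := by
  have h := sub_eq_zero.mp (Matrix.isNilpotent_charpoly_sub_pow_of_isNilpotent hP).eq_zero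
  have h' := P.eval_charpoly 1
  rw [h] at h'
  simpa using h'.symm

lemma parentMatrix_mulVec (r : V) (f : V → V) (v : V → R) (i : V) :
    (parentMatrix R r f).mulVec v i = if i = r then v r else v i - v (f i) := by
  by_cases h : i = r <;>
    simp [parentMatrix, Matrix.mulVec_eq_sum, h, mul_sub, Pi.single_apply, Finset.sum_sub_distrib]

lemma det_parentMatrix_of_reaches [IsDomain R] {r : V} {f : V → V} (hr : f r = r)
    (hf : ∀ i, ∃ m, f^[m] i = r) : (parentMatrix R r f).det = 1 := by
  set P : Matrix V V R := 1 - parentMatrix R r f with hPdef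
  have hP (v : V → R) (i : V) : P.mulVec v i = if i = r then 0 else v (f i) := by
    rw [hPdef, Matrix.sub_mulVec, Pi.sub_apply, parentMatrix_mulVec, Matrix.one_mulVec]
    split_ifs with h <;> simp [h]
  have hpow (m : ℕ) : ∀ (v : V → R) (i : V), f^[m] i = r → (P ^ (m + 1)).mulVec v i = 0 := by
    induction m with
    | zero =>
      intro v i hi
      rw [zero_add, pow_one, hP, if_pos (by simpa using hi)]
    | succ m ih =>
      intro v i hi
      rw [pow_succ', ← Matrix.mulVec_mulVec, hP]
      split_ifs with h
      · rfl
      · exact ih v _ hi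
  choose d hd using hf
  have hnil : IsNilpotent P := by
    refine ⟨Finset.univ.sup d + 1, ?_⟩
    refine Matrix.ext_of_mulVec_single fun j => funext fun i => ?_
    rw [hpow _ _ i, Matrix.zero_mulVec, Pi.zero_apply]
    obtain ⟨c, hc⟩ := Nat.exists_eq_add_of_le (Finset.le_sup (f := d) (Finset.mem_univ i))
    rw [hc, add_comm, Function.iterate_add_apply, hd, Function.iterate_fixed hr]
  rw [← Matrix.det_one_sub_of_isNilpotent hnil, hPdef, sub_sub_cancel]

lemma det_parentMatrix_of_not_reaches [IsDomain R] {r : V} {f : V → V} (hr : f r = r)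
    (hf : ¬ ∀ i, ∃ m, f^[m] i = r) : (parentMatrix R r f).det = 0 := by
  rw [← Matrix.exists_mulVec_eq_zero_iff]
  push Not at hf
  obtain ⟨i₀, hi₀⟩ := hf
  refine ⟨fun i => if ∃ m, f^[m] i = r then 0 else 1, fun h => ?_, funext fun i => ?_⟩
  · simpa [hi₀] using congrFun h i₀
  · rw [parentMatrix_mulVec]
    have hiff : (∃ m, f^[m] (f i) = r) ↔ ∃ m, f^[m] i = r := by
      refine ⟨fun ⟨m, hm⟩ => ⟨m + 1, hm⟩, fun ⟨m, hm⟩ => ⟨m, ?_⟩⟩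
      rw [← Function.iterate_succ_apply, Function.iterate_succ_apply', hm, hr]
    split_ifs with h1 h2 h3 h4 <;> simp_all
    exact absurd rfl (h2 0)

end Determinants

section Trees

variable {V : Type*} {r : V} {f g : V → V}

lemma parentGraph_le {G : SimpleGraph V} (hr : f r = r) (h : ∀ i, i ≠ r → G.Adj i (f i)) :
    parentGraph f ≤ G := by
  have hadj (x y : V) (hne : x ≠ y) (hxy : f x = y) : G.Adj x y := by
    rw [← hxy]
    refine h x ?_
    rintro rfl
    exact hne (hr.symm.trans hxy)
  rintro x y ⟨hne, hxy | hyx⟩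
  · exact hadj x y hne hxy
  · exact (hadj y x hne.symm hyx).symm

lemma connected_parentGraph (hf : ∀ i, ∃ m, f^[m] i = r) : (parentGraph f).Connected := by
  have key (m : ℕ) : ∀ i, f^[m] i = r → (parentGraph f).Reachable i r := by
    induction m with
    | zero => rintro i rfl; exact SimpleGraph.Reachable.refl _
    | succ m ih =>
      intro i hi
      refine SimpleGraph.Reachable.trans ?_ (ih (f i) hi)
      by_cases h : i = f i
      · rw [← h]
      · exact SimpleGraph.Adj.reachable (by simp [parentGraph, h])
  have key' (i : V) : (parentGraph f).Reachable i r := (hf i).elim fun m hm => key m i hm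
  exact SimpleGraph.connected_iff_exists_forall_reachable _ |>.mpr ⟨r, fun i => (key' i).symm⟩

lemma isTree_parentGraph [Finite V] (hr : f r = r) (hf : ∀ i, ∃ m, f^[m] i = r) :
    (parentGraph f).IsTree := by
  classical
  have := Fintype.ofFinite V
  have hc := connected_parentGraph hf
  refine SimpleGraph.isTree_iff_connected_and_card.mpr ⟨hc, ?_⟩
  refine le_antisymm ?_ hc.card_vert_le_card_edgeSet_add_one
  have hsub : (parentGraph f).edgeSet ⊆
      ((Finset.univ.erase r).image fun i => s(i, f i) : Finset (Sym2 V)) := by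
    intro e
    induction e with | _ x y =>
    simp only [parentGraph, SimpleGraph.mem_edgeSet, SimpleGraph.fromRel_adj, Finset.coe_image,
      Set.mem_image, Finset.mem_coe, Finset.mem_erase, Finset.mem_univ, and_true]
    rintro ⟨hne, h | h⟩
    · refine ⟨x, ?_, by rw [h]⟩
      rintro rfl
      exact hne (hr.symm.trans h)
    · refine ⟨y, ?_, by rw [h, Sym2.eq_swap]⟩
      rintro rfl
      exact hne (h.symm.trans hr)
  have hcard := (Set.ncard_le_ncard hsub (Finset.finite_toSet _)).trans
    ((Set.ncard_coe_finset _).le.trans Finset.card_image_le)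
  rw [Finset.card_erase_of_mem (Finset.mem_univ r), Finset.card_univ] at hcard
  have hpos : 0 < Fintype.card V := Fintype.card_pos_iff.mpr ⟨r⟩
  rw [Nat.card_coe_set_eq, Nat.card_eq_fintype_card]
  omega

lemma parentGraph_injective (hrf : f r = r) (hrg : g r = r)
    (hg : ∀ i, ∃ m, g^[m] i = r) (hfix : ∀ i, i ≠ r → g i ≠ i)
    (h : parentGraph f = parentGraph g) : f = g := by
  by_contra hne
  obtain ⟨i₀, hi₀⟩ := Function.ne_iff.mp hne
  have hstep (i : V) (hi : f i ≠ g i) : f (g i) ≠ g (g i) := by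
    have hir : i ≠ r := by
      rintro rfl
      exact hi (hrf.trans hrg.symm)
    have hadj : (parentGraph f).Adj i (g i) := by
      rw [h]
      simp [parentGraph, (hfix i hir).symm]
    have hfg : f (g i) = i := by
      simpa [parentGraph, hi, (hfix i hir).symm] using hadj
    rw [hfg]
    intro hgg
    obtain ⟨m, hm⟩ := hg i
    have h2 : ∀ m, g^[m] i = i ∨ g^[m] i = g i := by
      intro m
      induction m with
      | zero => simp
      | succ m ih =>
        rw [Function.iterate_succ_apply']
        rcases ih with ih | ih <;> rw [ih]
        · exact Or.inr rfl
        · exact Or.inl hgg.symm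
    rcases h2 m with h2 | h2
    · exact hir (h2.symm.trans hm)
    · have : g i = r := h2.symm.trans hm
      rw [this, hrg] at hgg
      exact hir hgg
  obtain ⟨m, hm⟩ := hg i₀
  have hbad : ∀ m, f (g^[m] i₀) ≠ g (g^[m] i₀) := by
    intro m
    induction m with
    | zero => exact hi₀
    | succ m ih =>
      rw [Function.iterate_succ_apply']
      exact hstep _ ih
  exact hbad m (by rw [hm, hrf, hrg])

lemma exists_parentGraph_eq [Finite V] {H : SimpleGraph V} (hH : H.IsTree) (r : V) :
    ∃ f : V → V, f r = r ∧ (∀ i, i ≠ r → H.Adj i (f i)) ∧ (∀ i, ∃ m, f^[m] i = r) ∧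
      parentGraph f = H := by
  have hex (i : V) : ∃ u, (i = r → u = r) ∧ (i ≠ r → H.Adj i u ∧ H.dist u r < H.dist i r) := by
    by_cases hi : i = r
    · exact ⟨r, by simp [hi]⟩
    · obtain ⟨p, hp⟩ := (hH.connected i r).exists_walk_length_eq_dist
      cases p with
      | nil => exact absurd rfl hi
      | @cons _ u _ hadj p =>
        refine ⟨u, fun h => absurd h hi, fun _ => ⟨hadj, ?_⟩⟩
        rw [← hp, SimpleGraph.Walk.length_cons]
        exact Nat.lt_succ_of_le (SimpleGraph.dist_le p)
  choose f hfr hf using hex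
  have hr : f r = r := hfr r rfl
  have hreach (d : ℕ) : ∀ i, H.dist i r ≤ d → ∃ m, f^[m] i = r := by
    induction d with
    | zero => exact fun i hi => ⟨0, (hH.connected.dist_eq_zero_iff).mp (Nat.le_zero.mp hi)⟩
    | succ d ih =>
      intro i hi
      by_cases hir : i = r
      · exact ⟨0, hir⟩
      · obtain ⟨m, hm⟩ := ih (f i) (by have := (hf i hir).2; omega)
        exact ⟨m + 1, hm⟩
  have hreach' (i : V) : ∃ m, f^[m] i = r := hreach _ i le_rfl
  refine ⟨f, hr, fun i hi => (hf i hi).1, hreach', ?_⟩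
  have hle : parentGraph f ≤ H := parentGraph_le hr fun i hi => (hf i hi).1
  have h1 := (SimpleGraph.isTree_iff_connected_and_card.mp (isTree_parentGraph hr hreach')).2
  have h2 := (SimpleGraph.isTree_iff_connected_and_card.mp hH).2
  rw [Nat.card_coe_set_eq] at h1 h2
  exact SimpleGraph.edgeSet_injective (Set.eq_of_subset_of_ncard_le
    (SimpleGraph.edgeSet_subset_edgeSet.mpr hle) (by omega) (Set.toFinite _))

end Trees

section MatrixTree

variable {V : Type*} [Fintype V] [DecidableEq V] {R : Type*} [CommRing R]

/-- The choices of a neighbour for each vertex other than the root `r`, with `r` fixed. -/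
def parentChoices (G : SimpleGraph V) [DecidableRel G.Adj] (r : V) : Finset (V → V) :=
  Fintype.piFinset fun i => if i = r then {r} else G.neighborFinset i

lemma mem_parentChoices {G : SimpleGraph V} [DecidableRel G.Adj] {r : V} {f : V → V} :
    f ∈ parentChoices G r ↔ f r = r ∧ ∀ i, i ≠ r → G.Adj i (f i) := by
  simp only [parentChoices, Fintype.mem_piFinset]
  constructor
  · intro h
    refine ⟨by simpa using h r, fun i hi => by simpa [hi] using h i⟩
  · rintro ⟨h1, h2⟩ i
    by_cases hi : i = r
    · simp [hi, h1]
    · simpa [hi] using h2 i hi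

lemma numSpanningTrees_eq_card (G : SimpleGraph V) [DecidableRel G.Adj] (r : V) :
    numSpanningTrees G = ((parentChoices G r).filter fun f => ∀ i, ∃ m, f^[m] i = r).card := by
  rw [numSpanningTrees, ← Set.ncard_coe_finset, ← Set.InjOn.ncard_image (f := parentGraph)]
  · congr 1
    ext H
    simp only [Set.mem_ofPred_eq, Set.mem_image, Finset.mem_coe, Finset.mem_filter,
      mem_parentChoices]
    constructor
    · rintro ⟨hle, hH⟩
      obtain ⟨f, h1, h2, h3, h4⟩ := exists_parentGraph_eq hH r
      exact ⟨f, ⟨⟨h1, fun i hi => hle (h2 i hi)⟩, h3⟩, h4⟩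
    · rintro ⟨f, ⟨⟨h1, h2⟩, h3⟩, rfl⟩
      exact ⟨parentGraph_le h1 h2, isTree_parentGraph h1 h3⟩
  · intro f hf g hg h
    simp only [Finset.mem_coe, Finset.mem_filter, mem_parentChoices] at hf hg
    exact parentGraph_injective hf.1.1 hg.1.1 hg.2 (fun i hi => (hg.1.2 i hi).ne') h

lemma lapMatrix_row (G : SimpleGraph V) [DecidableRel G.Adj] (i : V) :
    G.lapMatrix R i = ∑ u ∈ G.neighborFinset i, (Pi.single i 1 - Pi.single u 1) := by
  funext j
  have h := G.lapMatrix_mulVec_apply (R := R) i (Pi.single j 1)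
  rw [Matrix.mulVec_single_one] at h
  rw [Finset.sum_apply]
  simp only [Pi.sub_apply, Finset.sum_sub_distrib, Finset.sum_const,
    SimpleGraph.card_neighborFinset_eq_degree, nsmul_eq_mul]
  refine h.trans ?_
  simp only [Pi.single_comm]

/-- **Kirchhoff's matrix-tree theorem.** -/
theorem det_lapMatrix_updateRow_single [IsDomain R] (G : SimpleGraph V) [DecidableRel G.Adj]
    (r : V) : ((G.lapMatrix R).updateRow r (Pi.single r 1)).det = numSpanningTrees G := by
  have hrows : (G.lapMatrix R).updateRow r (Pi.single r 1) = fun i =>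
      ∑ u ∈ (if i = r then {r} else G.neighborFinset i),
        (if i = r then (Pi.single r 1 : V → R) else Pi.single i 1 - Pi.single u 1) := by
    funext i
    by_cases hi : i = r
    · subst hi
      simp
    · simp [hi, lapMatrix_row]
  rw [hrows]
  change Matrix.detRowAlternating _ = _
  rw [← AlternatingMap.coe_multilinearMap, MultilinearMap.map_sum_finset,
    numSpanningTrees_eq_card G r, Finset.card_filter, Nat.cast_sum]
  refine Finset.sum_congr rfl fun f hf => ?_
  have hr := (mem_parentChoices.mp hf).1
  change (parentMatrix R r f).det = _
  split_ifs with h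
  · rw [det_parentMatrix_of_reaches hr h, Nat.cast_one]
  · rw [det_parentMatrix_of_not_reaches hr h, Nat.cast_zero]

/-- A form of the matrix-tree theorem that does not single out a vertex. -/
theorem det_lapMatrix_add_one [IsDomain R] [Nonempty V] (G : SimpleGraph V)
    [DecidableRel G.Adj] :
    (G.lapMatrix R + Matrix.of fun _ _ => 1).det =
      (Fintype.card V : R) ^ 2 * numSpanningTrees G := by
  obtain ⟨r⟩ := ‹Nonempty V›
  set L := G.lapMatrix R with hL
  have hrow (i : V) : ∑ j, L i j = 0 := by
    simpa [Matrix.mulVec, dotProduct] using congrFun (G.lapMatrix_mulVec_const_eq_zero (R := R)) i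
  have hcol (j : V) : ∑ i, L i j = 0 := by
    rw [← hrow j]
    exact Finset.sum_congr rfl fun i _ => (G.isSymm_lapMatrix (R := R)).apply j i
  have hsingle (u : V) : (L.updateRow r (Pi.single u 1)).det = numSpanningTrees G := by
    have hz : (L.updateRow r (Pi.single u 1 - Pi.single r 1)).det = 0 := by
      rw [← Matrix.exists_mulVec_eq_zero_iff]
      refine ⟨1, fun h => one_ne_zero (congrFun h r), funext fun i => ?_⟩
      by_cases hi : i = r
      · subst hi
        simp [Matrix.mulVec, dotProduct, Finset.sum_sub_distrib]
      · simp [Matrix.mulVec, Matrix.updateRow_ne hi, dotProduct, hrow]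
    rw [← det_lapMatrix_updateRow_single G r, ← hL,
      ← sub_add_cancel (Pi.single u 1 : V → R) (Pi.single r 1), Matrix.det_updateRow_add, hz,
      zero_add]
  have hones : (L.updateRow r 1).det = Fintype.card V * numSpanningTrees G := by
    have h1 : (1 : V → R) = ∑ u, Pi.single u 1 := by
      simpa using (Finset.univ_sum_single (1 : V → R)).symm
    have h2 := Matrix.detRowAlternating.map_update_sum Finset.univ r
      (fun u => (Pi.single u 1 : V → R)) L
    rw [h1]
    refine h2.trans ((Finset.sum_congr rfl fun u _ => hsingle u).trans ?_)
    simp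
  set M : Matrix V V R := L + Matrix.of fun _ _ => (1 : R) with hM
  have hsum := Matrix.det_updateRow_sum M r 1
  rw [Pi.one_apply, one_smul] at hsum
  have hrowsum : ∑ k, (1 : V → R) k • M k = (Fintype.card V : R) • (1 : V → R) := by
    funext j
    have hj : ∑ i, M i j = Fintype.card V := by simp [hM, Finset.sum_add_distrib, hcol]
    simpa [Finset.sum_apply j Finset.univ (fun i => M i)] using hj
  rw [← hsum, hrowsum, Matrix.det_updateRow_smul]
  have hsub : (M.updateRow r 1).det = (L.updateRow r 1).det := by
    refine Matrix.det_eq_of_forall_row_eq_smul_add_const (fun i => if i = r then 0 else 1) r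
      (by simp) fun i j => ?_
    by_cases hi : i = r
    · subst hi
      simp
    · simp [hM, hi]
  rw [hsub, hones]
  ring

end MatrixTree

section Circulant

/-- The matrix of the discrete Fourier transform on `ZMod N`. -/
noncomputable def fourierMatrix (N : ℕ) [NeZero N] : Matrix (ZMod N) (ZMod N) ℂ :=
  Matrix.of fun i j => ZMod.stdAddChar (i * j)

lemma det_fourierMatrix_ne_zero (N : ℕ) [NeZero N] : (fourierMatrix N).det ≠ 0 := by
  have h : fourierMatrix N * Matrix.of (fun i j => ZMod.stdAddChar (-(i * j))) =
      (N : ℂ) • (1 : Matrix (ZMod N) (ZMod N) ℂ) := by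
    ext i j
    have hsum := AddChar.sum_mulShift (i - j) (ZMod.isPrimitive_stdAddChar N)
    simp only [fourierMatrix, Matrix.mul_apply, Matrix.of_apply, Matrix.smul_apply,
      Matrix.one_apply, ← AddChar.map_add_eq_mul, smul_eq_mul]
    convert hsum using 2
    · rename_i x _
      congr 1
      ring
    · simp [sub_eq_zero]
  intro h0
  have hdet := congrArg Matrix.det h
  rw [Matrix.det_mul, h0, zero_mul, Matrix.det_smul, Matrix.det_one, mul_one] at hdet
  exact pow_ne_zero _ (Nat.cast_ne_zero.mpr (NeZero.ne N)) hdet.symm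

lemma ZMod.natCast_self_sub {N m : ℕ} (h : m ≤ N) : ((N - m : ℕ) : ZMod N) = -(m : ZMod N) := by
  rw [Nat.cast_sub h, ZMod.natCast_self, zero_sub]

/-- The jumps of `circulantOdd n s`, together with their negatives, as residues in `[0, 2n)`. -/
def oddJumps (n : ℕ) {k : ℕ} (s : Fin k → ℕ) : Fin k ⊕ Fin k ⊕ Unit → ℕ :=
  Sum.elim s (Sum.elim (fun l => 2 * n - s l) fun _ => n)

variable {n k : ℕ} {s : Fin k → ℕ}

lemma oddJumps_pos (h1 : ∀ j, 1 ≤ s j) (h2 : ∀ j, s j < n) (hn : 0 < n)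
    (x : Fin k ⊕ Fin k ⊕ Unit) : 0 < oddJumps n s x := by
  rcases x with l | l | _
  · exact h1 l
  · have := h2 l
    simp only [oddJumps, Sum.elim_inr, Sum.elim_inl]
    omega
  · exact hn

lemma oddJumps_lt (h1 : ∀ j, 1 ≤ s j) (h2 : ∀ j, s j < n) (hn : 0 < n)
    (x : Fin k ⊕ Fin k ⊕ Unit) : oddJumps n s x < 2 * n := by
  rcases x with l | l | _ <;> simp only [oddJumps, Sum.elim_inr, Sum.elim_inl]
  · have := h2 l
    omega
  · have := h1 l
    omega
  · omega

lemma oddJumps_injective (hs : Function.Injective s) (h2 : ∀ j, s j < n) :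
    Function.Injective (oddJumps n s) := by
  rintro (a | a | _) (b | b | _) h <;>
    simp only [oddJumps, Sum.elim_inr, Sum.elim_inl] at h
  · rw [hs h]
  · have := h2 a; have := h2 b; omega
  · have := h2 a; omega
  · have := h2 a; have := h2 b; omega
  · have := h2 a
    have := h2 b
    rw [hs (by omega : s a = s b)]
  · have := h2 a; omega
  · have := h2 b; omega
  · have := h2 b; omega
  · rfl

lemma circulantOdd_adj_iff (h1 : ∀ j, 1 ≤ s j) (h2 : ∀ j, s j < n) (hn : 0 < n)
    (i u : ZMod (2 * n)) :
    (circulantOdd n s).Adj i u ↔ ∃ x, i + (oddJumps n s x : ZMod (2 * n)) = u := by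
  have hnn : (n : ZMod (2 * n)) + n = 0 := by
    simpa [two_mul] using ZMod.natCast_self (2 * n)
  have hneg (l : Fin k) : ((2 * n - s l : ℕ) : ZMod (2 * n)) = -(s l : ZMod (2 * n)) :=
    ZMod.natCast_self_sub (by have := h2 l; omega)
  rw [circulantOdd, SimpleGraph.circulantGraph_adj]
  constructor
  · rintro ⟨-, (⟨l, hl⟩ | hl) | (⟨l, hl⟩ | hl)⟩
    · refine ⟨Sum.inr (Sum.inl l), ?_⟩
      simp only [oddJumps, Sum.elim_inr, Sum.elim_inl, hneg, ← hl]
      ring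
    · refine ⟨Sum.inr (Sum.inr ()), ?_⟩
      have hl' : i - u = n := hl
      simp only [oddJumps, Sum.elim_inr]
      linear_combination hnn + hl'
    · refine ⟨Sum.inl l, ?_⟩
      simp only [oddJumps, Sum.elim_inl, ← hl]
      ring
    · refine ⟨Sum.inr (Sum.inr ()), ?_⟩
      have hl' : u - i = n := hl
      simp only [oddJumps, Sum.elim_inr, ← hl']
      ring
  · rintro ⟨x, rfl⟩
    refine ⟨fun h => ?_, ?_⟩
    · have h0 : (oddJumps n s x : ZMod (2 * n)) = 0 := by simpa using h.symm
      exact (Nat.le_of_dvd (oddJumps_pos h1 h2 hn x)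
        ((ZMod.natCast_eq_zero_iff _ _).mp h0)).not_gt (oddJumps_lt h1 h2 hn x)
    · rcases x with l | l | _
      · exact Or.inr (Or.inl ⟨l, by simp [oddJumps]⟩)
      · exact Or.inl (Or.inl ⟨l, by simp [oddJumps, hneg]⟩)
      · exact Or.inr (Or.inr (by simp [oddJumps]))

lemma sum_neighborFinset_circulantOdd [NeZero (2 * n)] [DecidableRel (circulantOdd n s).Adj]
    (hs : Function.Injective s) (h1 : ∀ j, 1 ≤ s j) (h2 : ∀ j, s j < n) (hn : 0 < n)
    (h : ZMod (2 * n) → ℂ) (i : ZMod (2 * n)) :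
    ∑ u ∈ (circulantOdd n s).neighborFinset i, h u =
      ∑ l, (h (i + s l) + h (i - s l)) + h (i + n) := by
  have hneg (l : Fin k) : ((2 * n - s l : ℕ) : ZMod (2 * n)) = -(s l : ZMod (2 * n)) :=
    ZMod.natCast_self_sub (by have := h2 l; omega)
  have hnbr : (circulantOdd n s).neighborFinset i =
      Finset.univ.image fun x => i + (oddJumps n s x : ZMod (2 * n)) := by
    ext u
    simp [circulantOdd_adj_iff h1 h2 hn]
  have hinj : Function.Injective fun x => i + (oddJumps n s x : ZMod (2 * n)) := by
    intro x y hxy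
    have hval := congrArg ZMod.val (add_left_cancel hxy)
    rw [ZMod.val_natCast_of_lt (oddJumps_lt h1 h2 hn x),
      ZMod.val_natCast_of_lt (oddJumps_lt h1 h2 hn y)] at hval
    exact oddJumps_injective hs h2 hval
  rw [hnbr, Finset.sum_image hinj.injOn, Fintype.sum_sum_type, Fintype.sum_sum_type,
    Finset.sum_add_distrib, ← add_assoc]
  simp [oddJumps, hneg, sub_eq_add_neg]

/-- The Laplacian eigenvalue of `circulantOdd n s` at the character `j`. -/
noncomputable def oddEigenvalue (n : ℕ) [NeZero (2 * n)] {k : ℕ} (s : Fin k → ℕ)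
    (j : ZMod (2 * n)) : ℂ :=
  2 * k + 1 - ∑ l, (ZMod.stdAddChar ((s l : ZMod (2 * n)) * j) +
      ZMod.stdAddChar (-((s l : ZMod (2 * n)) * j))) -
    ZMod.stdAddChar ((n : ZMod (2 * n)) * j)

lemma lapMatrix_circulantOdd_add_one_mul_fourierMatrix [NeZero (2 * n)]
    [DecidableRel (circulantOdd n s).Adj] (hs : Function.Injective s) (h1 : ∀ j, 1 ≤ s j)
    (h2 : ∀ j, s j < n) (hn : 0 < n) :
    ((circulantOdd n s).lapMatrix ℂ + Matrix.of fun _ _ => 1) * fourierMatrix (2 * n) =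
      fourierMatrix (2 * n) * Matrix.diagonal fun j =>
        oddEigenvalue n s j + if j = 0 then ((2 * n : ℕ) : ℂ) else 0 := by
  ext i j
  have hdeg : ((circulantOdd n s).degree i : ℂ) = 2 * k + 1 := by
    have h := sum_neighborFinset_circulantOdd hs h1 h2 hn (fun _ => 1) i
    simp only [Finset.sum_const, SimpleGraph.card_neighborFinset_eq_degree, nsmul_eq_mul,
      mul_one, Finset.card_univ, Fintype.card_fin] at h
    rw [h]
    ring
  have hL : ((circulantOdd n s).lapMatrix ℂ * fourierMatrix (2 * n)) i j =
      ZMod.stdAddChar (i * j) * oddEigenvalue n s j := by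
    have h := (circulantOdd n s).lapMatrix_mulVec_apply i
      (fun u => (ZMod.stdAddChar (u * j) : ℂ))
    rw [sum_neighborFinset_circulantOdd hs h1 h2 hn, hdeg] at h
    refine h.trans ?_
    simp only [add_mul, sub_eq_add_neg, neg_mul, AddChar.map_add_eq_mul, oddEigenvalue,
      ← mul_add, ← Finset.mul_sum]
    ring
  have hJ : ((Matrix.of fun _ _ => 1 : Matrix (ZMod (2 * n)) (ZMod (2 * n)) ℂ) *
      fourierMatrix (2 * n)) i j = if j = 0 then ((2 * n : ℕ) : ℂ) else 0 := by
    have h := AddChar.sum_mulShift j (ZMod.isPrimitive_stdAddChar (2 * n))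
    rw [ZMod.card] at h
    simp only [Matrix.mul_apply, fourierMatrix, Matrix.of_apply, one_mul]
    rw [h]
    split_ifs <;> simp
  rw [add_mul, Matrix.add_apply, hL, hJ, Matrix.mul_diagonal, mul_add]
  by_cases hj : j = 0 <;> simp [hj, fourierMatrix]

lemma oddEigenvalue_zero [NeZero (2 * n)] : oddEigenvalue n s 0 = 0 := by
  simp [oddEigenvalue]
  ring

/-- The number of spanning trees in terms of the nonzero Laplacian eigenvalues. -/
lemma mul_numSpanningTrees_circulantOdd [NeZero (2 * n)] (hs : Function.Injective s)
    (h1 : ∀ j, 1 ≤ s j) (h2 : ∀ j, s j < n) (hn : 0 < n) :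
    ((2 * n : ℕ) : ℂ) * numSpanningTrees (circulantOdd n s) =
      ∏ j ∈ Finset.univ.erase 0, oddEigenvalue n s j := by
  have hF := congrArg Matrix.det (lapMatrix_circulantOdd_add_one_mul_fourierMatrix hs h1 h2 hn)
  rw [Matrix.det_mul, Matrix.det_mul, mul_comm, Matrix.det_diagonal] at hF
  have hdet := mul_left_cancel₀ (det_fourierMatrix_ne_zero (2 * n)) hF
  rw [det_lapMatrix_add_one, ZMod.card, ← Finset.mul_prod_erase _ _ (Finset.mem_univ 0),
    oddEigenvalue_zero, zero_add, if_pos rfl, pow_two, mul_assoc] at hdet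
  refine (mul_left_cancel₀ (Nat.cast_ne_zero.mpr (NeZero.ne _)) hdet).trans ?_
  refine Finset.prod_congr rfl fun j hj => ?_
  rw [if_neg (Finset.ne_of_mem_erase hj), add_zero]

lemma prod_univ_erase_zero_zmod (N : ℕ) [NeZero N] (g : ZMod N → ℂ) :
    ∏ j ∈ Finset.univ.erase 0, g j = ∏ j ∈ Finset.Ico 1 N, g (j : ZMod N) := by
  symm
  refine Finset.prod_nbij' (fun j => (j : ZMod N)) ZMod.val (fun j hj => ?_) (fun j hj => ?_)
    (fun j hj => ?_) (fun j _ => ZMod.natCast_zmod_val j) fun _ _ => rfl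
  · rw [Finset.mem_Ico] at hj
    refine Finset.mem_erase.mpr ⟨fun h => ?_, Finset.mem_univ _⟩
    exact (Nat.le_of_dvd hj.1 ((ZMod.natCast_eq_zero_iff _ _).mp h)).not_gt hj.2
  · rw [Finset.mem_Ico]
    exact ⟨Nat.one_le_iff_ne_zero.mpr ((ZMod.val_ne_zero j).mpr (Finset.ne_of_mem_erase hj)),
      ZMod.val_lt j⟩
  · exact ZMod.val_natCast_of_lt (Finset.mem_Ico.mp hj).2

lemma oddEigenvalue_natCast [NeZero (2 * n)] (hn : 0 < n) (j : ℕ) :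
    oddEigenvalue n s (j : ZMod (2 * n)) =
      (2 * (k : ℂ) + 1 -
        ∑ l : Fin k,
          ((Complex.exp (Real.pi * Complex.I / n) ^ (j : ℤ)) ^ (s l : ℤ)
            + (Complex.exp (Real.pi * Complex.I / n) ^ (j : ℤ)) ^ (-(s l : ℤ))))
        - (-1 : ℂ) ^ (j : ℕ) := by
  have hn0 : (n : ℂ) ≠ 0 := Nat.cast_ne_zero.mpr hn.ne'
  set ε := Complex.exp (Real.pi * Complex.I / n) with hε
  have hψ (m : ℤ) : (ZMod.stdAddChar (m : ZMod (2 * n)) : ℂ) = ε ^ m := by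
    rw [ZMod.stdAddChar_coe, hε, ← Complex.exp_int_mul]
    congr 1
    push_cast
    field_simp
  have hεn : ε ^ (n : ℤ) = -1 := by
    rw [hε, ← Complex.exp_int_mul, ← Complex.exp_pi_mul_I]
    congr 1
    push_cast
    field_simp
  have e1 (m : ℕ) : (ZMod.stdAddChar ((m : ZMod (2 * n)) * (j : ZMod (2 * n))) : ℂ) =
      (ε ^ (j : ℤ)) ^ (m : ℤ) := by
    rw [← zpow_mul, ← hψ]
    congr 1
    push_cast
    ring
  have e2 (m : ℕ) :
      (ZMod.stdAddChar (-((m : ZMod (2 * n)) * (j : ZMod (2 * n)))) : ℂ) =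
        (ε ^ (j : ℤ)) ^ (-(m : ℤ)) := by
    rw [← zpow_mul, ← hψ]
    congr 1
    push_cast
    ring
  have e3 : (ε ^ (j : ℤ)) ^ (n : ℤ) = (-1) ^ j := by
    rw [zpow_comm, hεn, zpow_natCast]
  simp only [oddEigenvalue, e1, e2, e3]

end Circulant

/-- the number of spanning trees of `C_{2n}(s_1,…,s_k,n)` equals
`(1/(2n)) ∏_{j=1}^{2n-1} (L(ε_{2n}^j) - (-1)^j)` where `ε_{2n} = e^{πi/n}` and
`L(z) = 2k + 1 - ∑_{l=1}^k (z^{s_l} + z^{-s_l})`. -/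
theorem statement2 (n k : ℕ) (hn : 2 ≤ n) (hk : 0 < k) (s : Fin k → ℕ)
    (hmono : StrictMono s) (h1 : ∀ j, 1 ≤ s j) (h2 : ∀ j, s j < n) :
    (numSpanningTrees (circulantOdd n s) : ℂ) =
      (1 / (2 * n)) * ∏ j ∈ Finset.Ico 1 (2 * n),
        ((2 * (k : ℂ) + 1 -
          ∑ l : Fin k,
            ((Complex.exp (Real.pi * Complex.I / n) ^ (j : ℤ)) ^ (s l : ℤ)
              + (Complex.exp (Real.pi * Complex.I / n) ^ (j : ℤ)) ^ (-(s l : ℤ))))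
          - (-1 : ℂ) ^ (j : ℕ)) := by
  have hn0 : 0 < n := by omega
  have : NeZero (2 * n) := ⟨by omega⟩
  have h := mul_numSpanningTrees_circulantOdd hmono.injective h1 h2 hn0
  rw [prod_univ_erase_zero_zmod] at h
  simp only [oddEigenvalue_natCast hn0] at h
  have h2n : (2 * (n : ℂ)) ≠ 0 := mul_ne_zero two_ne_zero (Nat.cast_ne_zero.mpr hn0.ne')
  rw [← h, Nat.cast_mul, Nat.cast_ofNat, ← mul_assoc, one_div_mul_cancel h2n, one_mul]
end

section
/- Let n be even, and let 1 ≤ s_1 < s_2 < … < s_k < n/2 be integers with gcd(s_1,…,s_k,n) = 1. Let p be the number of odd elements among s_1,…,s_k and let q be the square-free part of p, i.e. the unique square-free positive integer q such that p = q·r² for some positive integer r. Then there exists a nonnegative integer a such that the number of spanning trees of C_n(s_1,…,s_k) equals q · n · a². -/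
open Polynomial Complex Finset
open scoped Classical

namespace SimpleGraph

variable {V : Type*}

/-- A map sending every vertex other than the root `r` to a neighbour in `G`, such that the root is
fixed and is eventually reached from every vertex. -/
structure IsParentMap (G : SimpleGraph V) (r : V) (f : V → V) : Prop where
  root : f r = r
  adj : ∀ v, v ≠ r → G.Adj v (f v)
  reach : ∀ v, ∃ k, f^[k] v = r

/-- The graph joining every vertex `v` to `f v`. -/
def parentGraph (f : V → V) : SimpleGraph V := fromRel fun v w => f v = w

lemma parentGraph_adj {f : V → V} {v w : V} :
    (parentGraph f).Adj v w ↔ v ≠ w ∧ (f v = w ∨ f w = v) := by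
  simp [parentGraph]

namespace IsParentMap

variable {G : SimpleGraph V} {r : V} {f g : V → V}

/-- The number of steps of `f` needed to reach the root. -/
noncomputable def depth (hf : G.IsParentMap r f) (v : V) : ℕ := Nat.find (hf.reach v)

lemma iterate_depth (hf : G.IsParentMap r f) (v : V) : f^[hf.depth v] v = r :=
  Nat.find_spec (hf.reach v)

lemma depth_apply_lt (hf : G.IsParentMap r f) {v : V} (hv : v ≠ r) :
    hf.depth (f v) < hf.depth v := by
  have h := hf.iterate_depth v
  rcases hd : hf.depth v with _ | d
  · rw [hd] at h
    exact absurd h hv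
  · rw [hd, Function.iterate_succ_apply] at h
    exact Nat.lt_succ_of_le (Nat.find_min' (hf.reach (f v)) h)

lemma parentGraph_le (hf : G.IsParentMap r f) : parentGraph f ≤ G := by
  intro v w h
  obtain ⟨hne, h | h⟩ := parentGraph_adj.1 h
  · subst h
    exact hf.adj v fun hv => hne (by rw [hv, hf.root])
  · subst h
    exact (hf.adj w fun hw => hne (by rw [hw, hf.root])).symm

lemma adj_parentGraph (hf : G.IsParentMap r f) {v : V} (hv : v ≠ r) :
    (parentGraph f).Adj v (f v) :=
  parentGraph_adj.2 ⟨(hf.adj v hv).ne, Or.inl rfl⟩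

lemma connected (hf : G.IsParentMap r f) : (parentGraph f).Connected := by
  have key : ∀ d v, hf.depth v = d → (parentGraph f).Reachable v r := by
    intro d
    induction d using Nat.strong_induction_on with
    | _ d ih =>
      intro v hv
      by_cases hvr : v = r
      · rw [hvr]
      · exact (hf.adj_parentGraph hvr).reachable.trans
          (ih _ (hv ▸ hf.depth_apply_lt hvr) _ rfl)
  exact { preconnected := fun u v => (key _ u rfl).trans (key _ v rfl).symm
          nonempty := ⟨r⟩ }

lemma isTree [Finite V] (hf : G.IsParentMap r f) : (parentGraph f).IsTree := by
  rw [isTree_iff_connected_and_card]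
  refine ⟨hf.connected, le_antisymm ?_ hf.connected.card_vert_le_card_edgeSet_add_one⟩
  have hsub : (parentGraph f).edgeSet ⊆ (fun v => s(v, f v)) '' ({r}ᶜ : Set V) := by
    intro e
    induction e with
    | _ v w =>
      rw [mem_edgeSet, parentGraph_adj]
      rintro ⟨hne, h | h⟩
      · exact ⟨v, fun hv => hne (by rw [← h, Set.mem_singleton_iff.1 hv, hf.root]), by simp [h]⟩
      · exact ⟨w, fun hw => hne (by rw [← h, Set.mem_singleton_iff.1 hw, hf.root]),
          by simp [h, Sym2.eq_swap]⟩
  have h1 := (Set.ncard_le_ncard hsub (Set.toFinite _)).trans (Set.ncard_image_le (Set.toFinite _))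
  have h2 := Set.ncard_add_ncard_compl ({r} : Set V)
  rw [Set.ncard_singleton] at h2
  rw [← Nat.card_coe_set_eq] at h1
  omega

lemma eq_of_parentGraph_eq (hf : G.IsParentMap r f) (hg : G.IsParentMap r g)
    (h : parentGraph f = parentGraph g) : f = g := by
  have key : ∀ d v, hg.depth v = d → f v = g v := by
    intro d
    induction d using Nat.strong_induction_on with
    | _ d ih =>
      intro v hv
      by_cases hvr : v = r
      · rw [hvr, hf.root, hg.root]
      · have hlt := hg.depth_apply_lt hvr
        have hadj := hg.adj_parentGraph hvr
        rw [← h] at hadj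
        obtain ⟨hne, h1 | h1⟩ := parentGraph_adj.1 hadj
        · exact h1
        · exfalso
          rw [ih _ (hv ▸ hlt) _ rfl] at h1
          have hgr : g v ≠ r := fun hgr => hvr (by rw [← h1, hgr, hg.root])
          have := hg.depth_apply_lt hgr
          rw [h1] at this
          omega
  exact funext fun v => key _ v rfl

end IsParentMap

lemma IsTree.exists_isParentMap {G H : SimpleGraph V} (r : V) (hle : H ≤ G) (hH : H.IsTree) :
    ∃ f, G.IsParentMap r f ∧ parentGraph f = H := by
  have hstep : ∀ v, ∃ w, v ≠ r → H.Adj v w ∧ H.dist w r < H.dist v r := by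
    intro v
    by_cases hv : v = r
    · exact ⟨v, fun h => absurd hv h⟩
    · obtain ⟨p, hp⟩ := hH.connected.exists_walk_length_eq_dist v r
      cases p with
      | nil => exact absurd rfl hv
      | @cons _ w _ h p =>
        refine ⟨w, fun _ => ⟨h, ?_⟩⟩
        have := dist_le p
        rw [Walk.length_cons] at hp
        omega
  choose f hf using hstep
  let g : V → V := fun v => if v = r then r else f v
  have hg : ∀ v, v ≠ r → g v = f v := fun v hv => if_neg hv
  have hgH : H.IsParentMap r g := by
    refine ⟨if_pos rfl, fun v hv => hg v hv ▸ (hf v hv).1, ?_⟩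
    have key : ∀ d v, H.dist v r = d → ∃ k, g^[k] v = r := by
      intro d
      induction d using Nat.strong_induction_on with
      | _ d ih =>
        intro v hv
        by_cases hvr : v = r
        · exact ⟨0, hvr⟩
        · obtain ⟨k, hk⟩ := ih _ (hv ▸ (hf v hvr).2) _ rfl
          exact ⟨k + 1, by rw [Function.iterate_succ_apply, hg v hvr, hk]⟩
    exact fun v => key _ v rfl
  refine ⟨g, ⟨hgH.root, fun v hv => hle (hgH.adj v hv), hgH.reach⟩, ?_⟩
  exact le_antisymm hgH.parentGraph_le
    ((isTree_iff_minimal_connected.1 hH).2 hgH.connected hgH.parentGraph_le)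

lemma ncard_isParentMap [Finite V] (G : SimpleGraph V) (r : V) :
    {f | G.IsParentMap r f}.ncard = numSpanningTrees G := by
  refine Set.ncard_congr (fun f _ => parentGraph f) (fun f hf => ⟨hf.parentGraph_le, hf.isTree⟩)
    (fun f g hf hg h => hf.eq_of_parentGraph_eq hg h) ?_
  rintro H ⟨hle, hH⟩
  obtain ⟨f, hf, rfl⟩ := hH.exists_isParentMap r hle
  exact ⟨f, hf, rfl⟩

section MatrixTree

variable [Fintype V] [DecidableEq V] {G : SimpleGraph V} [DecidableRel G.Adj]

/-- The term contributed by the choice of `u` to row `v` of the Laplacian matrix whose row `r` has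
been replaced by a unit vector. -/
def lapRow (G : SimpleGraph V) [DecidableRel G.Adj] (r v u : V) : V → ℤ :=
  if v = r then (if u = r then Pi.single r 1 else 0)
  else if G.Adj v u then Pi.single v 1 - Pi.single u 1 else 0

lemma sum_lapRow (r v : V) :
    ∑ u, lapRow G r v u = (G.lapMatrix ℤ).updateRow r (Pi.single r 1) v := by
  ext w
  by_cases hv : v = r
  · subst hv
    simp [lapRow, -Finset.sum_apply]
  · rw [Matrix.updateRow_ne hv]
    simp only [lapRow, if_neg hv, Finset.sum_apply]
    simp only [lapMatrix, degMatrix, Matrix.sub_apply, adjMatrix_apply, Matrix.diagonal_apply,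
      degree_eq_sum_if_adj]
    have : ∀ u, (if G.Adj v u then Pi.single v (1 : ℤ) - Pi.single u 1 else 0 : V → ℤ) w =
        (if v = w then (if G.Adj v u then 1 else 0) else 0) -
          (if u = w then (if G.Adj v u then 1 else 0) else 0) := by
      intro u
      by_cases h1 : G.Adj v u <;> simp [h1, Pi.single_apply, eq_comm]
    simp_rw [this, Finset.sum_sub_distrib]
    congr 1
    · split_ifs <;> simp
    · simp

lemma det_lapRow_of_isParentMap {r : V} {f : V → V} (hf : G.IsParentMap r f) :
    (Matrix.of fun v => lapRow G r v (f v)).det = 1 := by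
  have hrow : ∀ v w, Matrix.of (fun v => lapRow G r v (f v)) v w =
      (if w = v then 1 else 0) - (if v ≠ r ∧ w = f v then 1 else 0) := by
    intro v w
    by_cases hv : v = r
    · subst hv
      simp [lapRow, hf.root, Pi.single_apply]
    · simp [lapRow, hv, hf.adj v hv, Pi.single_apply]
  have hT : (Matrix.of fun v => lapRow G r v (f v)).BlockTriangular
      (fun v => OrderDual.toDual (hf.depth v)) := by
    intro v w hlt
    rw [OrderDual.toDual_lt_toDual] at hlt
    rw [hrow, if_neg, if_neg, sub_zero]
    · rintro ⟨hv, rfl⟩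
      exact absurd (hf.depth_apply_lt hv) (by omega)
    · rintro rfl
      exact absurd hlt (lt_irrefl _)
  rw [hT.det]
  refine Finset.prod_eq_one fun a _ => ?_
  suffices h : (Matrix.of fun v => lapRow G r v (f v)).toSquareBlock
      (fun v => OrderDual.toDual (hf.depth v)) a = 1 by
    rw [h, Matrix.det_one]
  ext ⟨v, hv⟩ ⟨w, hw⟩
  rw [Matrix.toSquareBlock_def, Matrix.of_apply, hrow, if_neg (c := _ ∧ _), Matrix.one_apply]
  · simp [eq_comm]
  · rintro ⟨h1, h2⟩
    have h3 := hf.depth_apply_lt h1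
    have h4 : hf.depth v = hf.depth w := OrderDual.toDual.injective (hv.trans hw.symm)
    rw [← show w = f v from h2, h4] at h3
    exact lt_irrefl _ h3

lemma det_lapRow_of_not_isParentMap {r : V} {f : V → V} (hf : ¬ G.IsParentMap r f) :
    (Matrix.of fun v => lapRow G r v (f v)).det = 0 := by
  by_cases hr : f r = r
  swap
  · exact Matrix.det_eq_zero_of_row_eq_zero r fun w => by simp [lapRow, hr]
  by_cases hadj : ∀ v, v ≠ r → G.Adj v (f v)
  swap
  · push Not at hadj
    obtain ⟨v, hv, hv'⟩ := hadj
    exact Matrix.det_eq_zero_of_row_eq_zero v fun w => by simp [lapRow, hv, hv']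
  have hreach : ∃ v, ∀ k, f^[k] v ≠ r := by
    by_contra! h
    exact hf ⟨hr, hadj, h⟩
  obtain ⟨v₀, hv₀⟩ := hreach
  rw [← Matrix.exists_mulVec_eq_zero_iff]
  have hx : ∀ v, (∀ k, f^[k] (f v) ≠ r) ↔ v ≠ r ∧ ∀ k, f^[k] v ≠ r := by
    intro v
    refine ⟨fun h => ⟨?_, ?_⟩, fun h k => h.2 (k + 1)⟩
    · rintro rfl
      exact h 0 hr
    · rintro (_ | k)
      · rintro rfl
        exact h 0 hr
      · exact h k
  refine ⟨fun v => if ∀ k, f^[k] v ≠ r then 1 else 0, ?_, ?_⟩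
  · intro h
    have := congrFun h v₀
    rw [if_pos hv₀] at this
    exact one_ne_zero this
  · ext v
    change lapRow G r v (f v) ⬝ᵥ _ = 0
    by_cases hv : v = r
    · subst hv
      simp only [lapRow, hr, if_true, single_dotProduct, one_mul]
      exact if_neg fun h => h 0 rfl
    · simp only [lapRow, if_neg hv, if_pos (hadj v hv), sub_dotProduct, single_dotProduct, one_mul,
        sub_eq_zero, hx v]
      simp [hv]

/-- The matrix-tree theorem. -/
theorem det_lapMatrix_updateRow (r : V) :
    ((G.lapMatrix ℤ).updateRow r (Pi.single r 1)).det = numSpanningTrees G := by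
  have h1 : (G.lapMatrix ℤ).updateRow r (Pi.single r 1) =
      Matrix.of fun v => ∑ u, lapRow G r v u := by
    ext v w
    rw [Matrix.of_apply, sum_lapRow]
  have h2 := (Matrix.detRowAlternating (n := V) (R := ℤ)).toMultilinearMap.map_sum
    (fun v u => lapRow G r v u)
  have h3 : ∀ f : V → V, (Matrix.of fun v => lapRow G r v (f v)).det =
      if G.IsParentMap r f then 1 else 0 := by
    intro f
    split_ifs with hf
    · exact det_lapRow_of_isParentMap hf
    · exact det_lapRow_of_not_isParentMap hf
  rw [h1]
  refine h2.trans ((Finset.sum_congr rfl fun f _ => h3 f).trans ?_)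
  rw [Finset.sum_boole, ← ncard_isParentMap G r, Set.ncard_eq_toFinset_card']
  congr 2
  ext f
  simp

end MatrixTree

end SimpleGraph

/-- If all rows and columns of `M` sum to zero, adding `1` to every entry multiplies the cofactor of
a diagonal entry by the square of the size. -/
lemma Matrix.det_add_one_of_sum_eq_zero {V R : Type*} [Fintype V] [DecidableEq V] [CommRing R]
    (M : Matrix V V R) (hrow : ∀ v, ∑ w, M v w = 0) (hcol : ∀ w, ∑ v, M v w = 0) (r : V) :
    (M + of fun _ _ => 1).det =
      (Fintype.card V : R) ^ 2 * (M.updateRow r (Pi.single r 1)).det := by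
  set n : R := (Fintype.card V : R) with hn
  have h1 : (M + of fun _ _ => 1).det = n * ((M + of fun _ _ => 1).updateRow r fun _ => 1).det := by
    have h := det_updateRow_sum (M + of fun _ _ => 1) r fun _ => 1
    rw [one_smul] at h
    rw [← h, ← det_updateRow_smul]
    congr 2
    ext w
    refine (Finset.sum_apply w _ _).trans ?_
    simp [Finset.sum_add_distrib, hcol, hn]
  set B := (M + of fun _ _ => 1).updateRow r fun _ => 1
  have h2 : B.det = n * (B.updateCol r fun _ => 1).det := by
    have h := det_updateCol_sum B r fun _ => 1
    rw [one_smul] at h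
    rw [← h, ← det_updateCol_smul]
    congr 2
    ext v
    by_cases hv : v = r
    · subst hv
      simp [B, hn]
    · simp [B, hv, Finset.sum_add_distrib, hrow, hn]
  have h3 : (B.updateCol r fun _ => 1).det =
      ((M.updateCol r 0).updateRow r fun _ => 1).det := by
    refine det_eq_of_forall_row_eq_smul_add_const (fun v => if v = r then 0 else 1) r (if_pos rfl)
      fun v w => ?_
    by_cases hv : v = r <;> by_cases hw : w = r <;> simp [B, updateRow_apply, hv, hw]
  have h4 : ((M.updateCol r 0).updateRow r fun _ => 1).det =
      ((M.updateCol r 0).updateRow r (Pi.single r 1)).det := by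
    rw [← det_transpose, ← det_transpose ((M.updateCol r 0).updateRow r (Pi.single r 1))]
    refine det_eq_of_forall_row_eq_smul_add_const (fun v => if v = r then 0 else 1) r (if_pos rfl)
      fun v w => ?_
    by_cases hv : v = r <;> by_cases hw : w = r <;> simp [updateRow_apply, hv, hw]
  have h5 : (M.updateRow r (Pi.single r 1)).det =
      ((M.updateCol r 0).updateRow r (Pi.single r 1)).det := by
    refine det_eq_of_forall_row_eq_smul_add_const (fun v => if v = r then 0 else M v r) r
      (if_pos rfl) fun v w => ?_
    by_cases hv : v = r <;> by_cases hw : w = r <;> simp [updateRow_apply, hv, hw]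
  rw [h1, h2, h3, h4, h5]
  ring

/-- The order of a group divides the size of a set on which it acts freely. -/
lemma AddAction.card_dvd_of_free {A X : Type*} [AddGroup A] [AddAction A X]
    (h : ∀ (a : A) (x : X), a +ᵥ x = x → a = 0) : Nat.card A ∣ Nat.card X := by
  have e := AddAction.selfEquivOrbitsQuotientProd (G := A) (X := X) fun x =>
    (AddSubgroup.eq_bot_iff_forall _).2 fun a ha => h a x ha
  rw [Nat.card_congr e, Nat.card_prod]
  exact dvd_mul_left _ _

namespace SimpleGraph

variable {A : Type*} [AddCommGroup A]

/-- Translates of graphs on an abelian group. -/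
instance translate : AddAction A (SimpleGraph A) where
  vadd a H := H.comap fun u => u - a
  zero_vadd H := by
    ext u v
    change H.Adj (u - 0) (v - 0) ↔ _
    simp
  add_vadd a b H := by
    ext u v
    change H.Adj (u - (a + b)) (v - (a + b)) ↔ H.Adj (u - a - b) (v - a - b)
    simp only [sub_sub]

lemma vadd_adj {a : A} {H : SimpleGraph A} {u v : A} :
    (a +ᵥ H).Adj u v ↔ H.Adj (u - a) (v - a) := Iff.rfl

lemma IsTree.vadd {H : SimpleGraph A} (hH : H.IsTree) (a : A) : (a +ᵥ H).IsTree :=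
  (Iso.isTree_iff (Iso.comap (Equiv.subRight a) H)).2 hH

lemma vadd_circulantGraph (a : A) (S : Set A) :
    a +ᵥ circulantGraph S = circulantGraph S := by
  ext u v
  simp [vadd_adj, circulantGraph_adj]

lemma vadd_le_vadd {a : A} {H G : SimpleGraph A} (h : H ≤ G) : a +ᵥ H ≤ a +ᵥ G :=
  fun _ _ huv => h huv

/-- A nonzero translation fixes no tree whose edges are not of order two. -/
lemma IsTree.eq_zero_of_vadd_eq [Finite A] {H : SimpleGraph A} (hH : H.IsTree)
    (h2 : ∀ u v, H.Adj u v → (u - v) + (u - v) ≠ 0) {a : A} (ha : a +ᵥ H = H) : a = 0 := by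
  have hst : ∀ b ∈ AddAction.stabilizer A H, ∀ u v, H.Adj u v → H.Adj (u + b) (v + b) := by
    intro b hb u v huv
    have : b +ᵥ H = H := hb
    rw [← this, vadd_adj]
    simpa using huv
  let act : AddAction (AddAction.stabilizer A H) H.edgeSet :=
    { vadd := fun b e => ⟨e.1.map (· + b.1), by
        obtain ⟨e, he⟩ := e
        induction e with
        | _ u v => exact hst b.1 b.2 u v he⟩
      zero_vadd := by
        rintro ⟨e, he⟩
        refine Subtype.ext ?_
        change e.map (· + 0) = e
        simp
      add_vadd := by
        rintro ⟨b, hb⟩ ⟨c, hc⟩ ⟨e, he⟩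
        refine Subtype.ext ?_
        change e.map (· + (b + c)) = (e.map (· + c)).map (· + b)
        rw [Sym2.map_map]
        congr 1
        ext u
        simp only [Function.comp]
        abel }
  have hdvd := AddAction.card_dvd_of_free (A := AddAction.stabilizer A H) (X := H.edgeSet) <| by
    rintro ⟨b, hb⟩ ⟨e, he⟩ hbe
    have hbe' : e.map (· + b) = e := congrArg Subtype.val hbe
    refine Subtype.ext ?_
    change b = 0
    induction e with
    | _ u v =>
      rw [Sym2.map_mk, Sym2.eq_iff] at hbe'
      obtain ⟨h, -⟩ | ⟨h, h'⟩ := hbe'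
      · simpa using h
      · refine absurd ?_ (h2 u v he)
        calc u - v + (u - v) = (v + b - v) + (u - (u + b)) := by rw [h, h']
          _ = 0 := by abel
  have hdvd' := AddSubgroup.card_addSubgroup_dvd_card (AddAction.stabilizer A H)
  rw [← (isTree_iff_connected_and_card.1 hH).2, Nat.dvd_add_right hdvd, Nat.dvd_one,
    AddSubgroup.card_eq_one] at hdvd'
  have : a ∈ AddAction.stabilizer A H := ha
  rwa [hdvd', AddSubgroup.mem_bot] at this

/-- The order of an abelian group divides the number of spanning trees of a circulant graph all of
whose jumps have order other than two. -/
lemma card_dvd_numSpanningTrees_circulantGraph [Finite A] (S : Set A)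
    (hS : ∀ x ∈ S, x ≠ 0 → x + x ≠ 0) : Nat.card A ∣ numSpanningTrees (circulantGraph S) := by
  let X := {H : SimpleGraph A | H ≤ circulantGraph S ∧ H.IsTree}
  let act : AddAction A X :=
    { vadd := fun a H => ⟨a +ᵥ H.1,
        (vadd_le_vadd H.2.1).trans_eq (vadd_circulantGraph a S), H.2.2.vadd a⟩
      zero_vadd := fun H => Subtype.ext (zero_vadd _ _)
      add_vadd := fun a b H => Subtype.ext (add_vadd _ _ _) }
  have h := AddAction.card_dvd_of_free (A := A) (X := X) <| by
    rintro a ⟨H, hle, hH⟩ ha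
    refine hH.eq_zero_of_vadd_eq (fun u v huv => ?_) (congrArg Subtype.val ha)
    have hadj := hle huv
    rw [circulantGraph_adj] at hadj
    obtain ⟨hne, hmem | hmem⟩ := hadj
    · exact hS _ hmem (sub_ne_zero.2 hne)
    · have := hS _ hmem (sub_ne_zero.2 (Ne.symm hne))
      rwa [← neg_sub u v, ← neg_add, neg_ne_zero] at this
  rwa [Nat.card_coe_set_eq] at h

end SimpleGraph

namespace ZMod

@[to_additive]
lemma prod_univ_eq_prod_range {M : Type*} [CommMonoid M] (n : ℕ) [NeZero n] (h : ZMod n → M) :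
    ∏ y, h y = ∏ i ∈ range n, h (i : ZMod n) := by
  refine Finset.prod_bij (fun y _ => y.val) (fun y _ => mem_range.2 y.val_lt)
    (fun y _ z _ hyz => val_injective n hyz) (fun i hi => ⟨i, mem_univ _, ?_⟩) fun y _ => ?_
  · exact val_cast_of_lt (mem_range.1 hi)
  · rw [natCast_zmod_val]

@[to_additive]
lemma prod_univ_eq_prod_half {M : Type*} [CommMonoid M] (m : ℕ) (h : ZMod (2 * (m + 1)) → M) :
    ∏ y, h y = h 0 * h ((m + 1 : ℕ) : ZMod (2 * (m + 1))) *
      ∏ i : Fin m, h ((i + 1 : ℕ) : ZMod (2 * (m + 1))) *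
        h (-((i + 1 : ℕ) : ZMod (2 * (m + 1)))) := by
  have hsplit : range (2 * (m + 1)) = range (m + 1 + (m + 1)) := by rw [two_mul]
  rw [prod_univ_eq_prod_range, hsplit, prod_range_add, prod_range_succ',
    prod_range_succ' (fun x => h ((m + 1 + x : ℕ) : ZMod (2 * (m + 1)))), Finset.prod_mul_distrib,
    Fin.prod_univ_eq_prod_range (fun i => h ((i + 1 : ℕ) : ZMod (2 * (m + 1)))),
    Fin.prod_univ_eq_prod_range (fun i => h (-((i + 1 : ℕ) : ZMod (2 * (m + 1)))))]
  have hneg : ∏ i ∈ range m, h ((m + 1 + (i + 1) : ℕ) : ZMod (2 * (m + 1))) =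
      ∏ i ∈ range m, h (-((i + 1 : ℕ) : ZMod (2 * (m + 1)))) := by
    refine Finset.prod_bij (fun i _ => m - 1 - i) (fun i hi => ?_) (fun i hi j hj hij => ?_)
      (fun i hi => ⟨m - 1 - i, ?_, ?_⟩) fun i hi => ?_
    · rw [mem_range] at hi ⊢
      omega
    · rw [mem_range] at hi hj
      omega
    · rw [mem_range] at hi ⊢
      omega
    · rw [mem_range] at hi
      omega
    · rw [mem_range] at hi
      congr 1
      rw [eq_neg_iff_add_eq_zero, ← Nat.cast_add,
        show m + 1 + (i + 1) + (m - 1 - i + 1) = 2 * (m + 1) by omega, natCast_self]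
  rw [hneg, Nat.cast_zero, add_zero]
  simp only [mul_comm, mul_assoc, mul_left_comm]

variable {n : ℕ} [NeZero n]

/-- The eigenvalue of the circulant matrix of `c` at the character `y ↦ stdAddChar (y * j)`. -/
noncomputable def circulantEigenvalue (c : ZMod n → ℂ) (j : ZMod n) : ℂ :=
  ∑ y, c y * stdAddChar (y * j)

lemma circulantEigenvalue_neg {c : ZMod n → ℂ} (hc : ∀ y, c (-y) = c y) (j : ZMod n) :
    circulantEigenvalue c (-j) = circulantEigenvalue c j := by
  refine Fintype.sum_equiv (Equiv.neg _) _ _ fun y => ?_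
  simp [hc]

lemma sum_sub_mul_stdAddChar (c : ZMod n → ℂ) (a b : ZMod n) :
    ∑ y, c (a - y) * stdAddChar (y * b) = stdAddChar (a * b) * circulantEigenvalue c (-b) := by
  rw [circulantEigenvalue, Finset.mul_sum]
  refine Fintype.sum_equiv (Equiv.subLeft a) _ _ fun y => ?_
  rw [Equiv.subLeft_apply, mul_left_comm, ← AddChar.map_add_eq_mul]
  congr 2
  ring

lemma sum_stdAddChar_mul (b : ZMod n) :
    ∑ y : ZMod n, (stdAddChar (y * b) : ℂ) = if b = 0 then (n : ℂ) else 0 := by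
  rw [AddChar.sum_mulShift b (isPrimitive_stdAddChar n), ZMod.card]
  split_ifs <;> simp

lemma det_circulant (c : ZMod n → ℂ) :
    (Matrix.circulant c).det = ∏ j, circulantEigenvalue c j := by
  let F : Matrix (ZMod n) (ZMod n) ℂ := Matrix.of fun x j => stdAddChar (x * j)
  let F' : Matrix (ZMod n) (ZMod n) ℂ := Matrix.of fun x j => stdAddChar (-(x * j))
  have hFF : F' * F = (n : ℂ) • 1 := by
    ext x z
    rw [Matrix.mul_apply, Matrix.smul_apply, Matrix.one_apply]
    have : ∀ y, F' x y * F y z = stdAddChar (y * (z - x)) := by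
      intro y
      simp only [F, F', Matrix.of_apply]
      rw [← AddChar.map_add_eq_mul]
      congr 1
      ring
    rw [Finset.sum_congr rfl fun y _ => this y, sum_stdAddChar_mul]
    simp [sub_eq_zero, eq_comm]
  have hF : F.det ≠ 0 := by
    intro h
    have := congrArg Matrix.det hFF
    rw [Matrix.det_mul, h, mul_zero, Matrix.det_smul, Matrix.det_one, mul_one] at this
    exact pow_ne_zero _ (NeZero.ne (n : ℂ)) this.symm
  have hCF : Matrix.circulant c * F =
      F * Matrix.diagonal fun j => circulantEigenvalue c (-j) := by
    ext x j
    rw [Matrix.mul_diagonal, Matrix.mul_apply]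
    exact sum_sub_mul_stdAddChar c x j
  have := congrArg Matrix.det hCF
  rw [Matrix.det_mul, Matrix.det_mul, mul_comm, Matrix.det_diagonal] at this
  rw [mul_left_cancel₀ hF this]
  exact Fintype.prod_equiv (Equiv.neg _) _ _ fun j => rfl

lemma stdAddChar_mul_half (m : ℕ) (x : ZMod (2 * (m + 1))) :
    (stdAddChar (-(x * ((m + 1 : ℕ) : ZMod (2 * (m + 1))))) : ℂ) =
      stdAddChar (x * ((m + 1 : ℕ) : ZMod (2 * (m + 1)))) := by
  congr 1
  rw [neg_eq_iff_add_eq_zero, ← mul_add, ← Nat.cast_add, ← two_mul, natCast_self, mul_zero]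

/-- The matrix through which the circulant matrix of `c` acts on odd functions. -/
def oddCirculant {R : Type*} [Sub R] (m : ℕ) (c : ZMod (2 * (m + 1)) → R) :
    Matrix (Fin m) (Fin m) R :=
  Matrix.of fun i j => c (((i + 1 : ℕ) : ZMod (2 * (m + 1))) - ((j + 1 : ℕ) : ZMod (2 * (m + 1)))) -
    c (((i + 1 : ℕ) : ZMod (2 * (m + 1))) + ((j + 1 : ℕ) : ZMod (2 * (m + 1))))

lemma det_oddCirculant (m : ℕ) {c : ZMod (2 * (m + 1)) → ℂ} (hc : ∀ y, c (-y) = c y) :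
    (oddCirculant m c).det =
      ∏ i : Fin m, circulantEigenvalue c ((i + 1 : ℕ) : ZMod (2 * (m + 1))) := by
  let e : Fin m → ZMod (2 * (m + 1)) := fun i => ((i + 1 : ℕ) : ZMod (2 * (m + 1)))
  let φ : ZMod (2 * (m + 1)) → ZMod (2 * (m + 1)) → ℂ := fun b y =>
    stdAddChar (y * b) - stdAddChar (-(y * b))
  let S : Matrix (Fin m) (Fin m) ℂ := Matrix.of fun i j => φ (e j) (e i)
  have hφ0 : ∀ b, φ b 0 = 0 := fun b => by simp [φ]
  have hφm : ∀ b, φ b ((m + 1 : ℕ) : ZMod (2 * (m + 1))) = 0 := fun b => by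
    simp only [φ]
    rw [mul_comm _ b, stdAddChar_mul_half, sub_self]
  have hφneg : ∀ b y, φ b (-y) = -φ b y := fun b y => by simp [φ]
  have hadd : ∀ i j, e i + e j ≠ 0 := by
    intro i j h
    simp only [e] at h
    rw [← Nat.cast_add, natCast_eq_zero_iff] at h
    have := Nat.le_of_dvd (by omega) h
    have := i.2
    have := j.2
    omega
  have hinj : ∀ i j, e i = e j → i = j := by
    intro i j h
    have h' := congrArg ZMod.val h
    have := i.2
    have := j.2
    simp only [e] at h'
    rw [val_cast_of_lt (by omega), val_cast_of_lt (by omega)] at h'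
    exact Fin.ext (by omega)
  have hSS : S * S = (-((2 * (m + 1) : ℕ) : ℂ)) • 1 := by
    ext i k
    have h1 := sum_univ_eq_sum_half m fun y => φ (e i) y * φ (e k) y
    have h2 : ∀ y, φ (e i) y * φ (e k) y = stdAddChar (y * (e i + e k)) -
        stdAddChar (y * (e i - e k)) - stdAddChar (y * (e k - e i)) +
        stdAddChar (y * -(e i + e k)) := by
      intro y
      have h3 : ∀ a b : ZMod (2 * (m + 1)), (stdAddChar (y * (a + b)) : ℂ) =
          stdAddChar (y * a) * stdAddChar (y * b) := fun a b => by
        rw [mul_add y a b, AddChar.map_add_eq_mul]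
      have h4 : y * -(e i + e k) = y * (-e i + -e k) := by ring
      rw [h4, sub_eq_add_neg (e i), sub_eq_add_neg (e k)]
      simp only [h3, φ, mul_neg]
      ring
    rw [Finset.sum_congr rfl fun y _ => h2 y, Finset.sum_add_distrib, Finset.sum_sub_distrib,
      Finset.sum_sub_distrib] at h1
    simp only [sum_stdAddChar_mul, hφ0, hφm, hφneg, neg_eq_zero, if_neg (hadd i k), zero_mul,
      neg_mul_neg, ← two_mul, ← Finset.mul_sum] at h1
    rw [Matrix.mul_apply, Matrix.smul_apply, Matrix.one_apply]
    have h5 : ∀ j, S i j * S j k = φ (e i) (e j) * φ (e k) (e j) := by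
      intro j
      simp only [S, φ, Matrix.of_apply, mul_comm (e i) (e j)]
    rw [Finset.sum_congr rfl fun j _ => h5 j]
    by_cases hik : i = k
    · subst hik
      simp only [sub_self, if_true, smul_eq_mul, mul_one] at h1 ⊢
      linear_combination (-1 / 2) * h1
    · rw [if_neg (sub_ne_zero.2 fun h => hik (hinj _ _ h)),
        if_neg (sub_ne_zero.2 fun h => hik (hinj _ _ h).symm)] at h1
      rw [if_neg hik, smul_zero]
      linear_combination (-1 / 2) * h1
  have hS : S.det ≠ 0 := by
    intro h
    have := congrArg Matrix.det hSS
    rw [Matrix.det_mul, h, mul_zero, Matrix.det_smul, Matrix.det_one, mul_one] at this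
    exact pow_ne_zero _ (neg_ne_zero.2 (NeZero.ne _)) this.symm
  have hMS : oddCirculant m c * S = S * Matrix.diagonal fun j => circulantEigenvalue c (e j) := by
    ext i k
    rw [Matrix.mul_diagonal, Matrix.mul_apply]
    have h1 := sum_univ_eq_sum_half m fun y => c (e i - y) * φ (e k) y
    have h2 : ∑ y, c (e i - y) * φ (e k) y =
        φ (e k) (e i) * circulantEigenvalue c (e k) := by
      have h3 := sum_sub_mul_stdAddChar c (e i) (-e k)
      simp only [mul_neg, neg_neg] at h3
      simp only [φ, mul_sub, Finset.sum_sub_distrib]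
      rw [h3, sum_sub_mul_stdAddChar, circulantEigenvalue_neg hc]
      ring
    rw [h2] at h1
    simp only [hφ0, hφm, hφneg, mul_zero, zero_add] at h1
    refine Eq.trans (Finset.sum_congr rfl fun j _ => ?_) h1.symm
    simp only [oddCirculant, S, e, Matrix.of_apply, sub_neg_eq_add]
    ring
  have := congrArg Matrix.det hMS
  rw [Matrix.det_mul, Matrix.det_mul, mul_comm, Matrix.det_diagonal] at this
  exact mul_left_cancel₀ hS this

end ZMod

section Circulant

variable {n k : ℕ}

/-- The function on `ZMod n` whose circulant matrix is the Laplacian matrix of `circulant n s`. -/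
def circulantLap (n : ℕ) {k : ℕ} (s : Fin k → ℕ) (z : ZMod n) : ℤ :=
  (if z = 0 then 2 * (k : ℤ) else 0) -
    ∑ i, ((if z = (s i : ZMod n) then 1 else 0) + (if z = -(s i : ZMod n) then 1 else 0))

lemma circulantLap_neg (s : Fin k → ℕ) (z : ZMod n) :
    circulantLap n s (-z) = circulantLap n s z := by
  have h : ∀ a : ZMod n, -z = a ↔ z = -a := fun a => neg_eq_iff_eq_neg
  simp only [circulantLap, h, neg_zero, neg_neg]
  congr 1
  exact Finset.sum_congr rfl fun i _ => add_comm (_ : ℤ) _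

lemma sum_circulantLap [NeZero n] (s : Fin k → ℕ) : ∑ z, circulantLap n s z = 0 := by
  simp only [circulantLap, Finset.sum_sub_distrib]
  rw [Finset.sum_comm]
  simp [Finset.sum_add_distrib]
  ring

lemma natCast_ne_neg_natCast {a b : ℕ} (ha : 1 ≤ a) (ha' : 2 * a < n) (hb' : 2 * b < n) :
    (a : ZMod n) ≠ -(b : ZMod n) := by
  intro h
  rw [eq_neg_iff_add_eq_zero, ← Nat.cast_add, ZMod.natCast_eq_zero_iff] at h
  have := Nat.le_of_dvd (by omega) h
  omega

lemma natCast_injective_of_strictMono {s : Fin k → ℕ} (hmono : StrictMono s)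
    (h2 : ∀ j, 2 * s j < n) {i j : Fin k} (h : (s i : ZMod n) = s j) : i = j := by
  have h' := congrArg ZMod.val h
  have hi := h2 i
  have hj := h2 j
  rw [ZMod.val_cast_of_lt (by omega), ZMod.val_cast_of_lt (by omega)] at h'
  exact hmono.injective h'

lemma sum_indicator_eq {s : Fin k → ℕ} (hmono : StrictMono s) (h1 : ∀ j, 1 ≤ s j)
    (h2 : ∀ j, 2 * s j < n) (z : ZMod n) :
    ∑ i, ((if z = (s i : ZMod n) then (1 : ℤ) else 0) + (if z = -(s i : ZMod n) then 1 else 0)) =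
      if ∃ i, z = (s i : ZMod n) ∨ z = -(s i : ZMod n) then 1 else 0 := by
  split_ifs with h
  · obtain ⟨i, rfl | rfl⟩ := h
    · rw [Finset.sum_eq_single i]
      · simp [natCast_ne_neg_natCast (h1 i) (h2 i) (h2 i)]
      · intro j _ hj
        rw [if_neg fun h => hj (natCast_injective_of_strictMono hmono h2 h).symm,
          if_neg (natCast_ne_neg_natCast (h1 i) (h2 i) (h2 j)), add_zero]
      · exact fun h => absurd (mem_univ i) h
    · rw [Finset.sum_eq_single i]
      · simp [(natCast_ne_neg_natCast (h1 i) (h2 i) (h2 i)).symm]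
      · intro j _ hj
        rw [if_neg (natCast_ne_neg_natCast (h1 j) (h2 j) (h2 i)).symm,
          if_neg fun h => hj (natCast_injective_of_strictMono hmono h2 (neg_injective h)).symm,
          add_zero]
      · exact fun h => absurd (mem_univ i) h
  · push Not at h
    exact Finset.sum_eq_zero fun i _ => by rw [if_neg (h i).1, if_neg (h i).2, add_zero]

lemma natCast_ne_zero_of_two_mul_lt {a : ℕ} (h1 : 1 ≤ a) (h2 : 2 * a < n) : (a : ZMod n) ≠ 0 := by
  intro h
  rw [ZMod.natCast_eq_zero_iff] at h
  have := Nat.le_of_dvd h1 h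
  omega

lemma lapMatrix_circulant [NeZero n] {s : Fin k → ℕ} (hmono : StrictMono s) (h1 : ∀ j, 1 ≤ s j)
    (h2 : ∀ j, 2 * s j < n) :
    (circulant n s).lapMatrix ℤ = Matrix.circulant (circulantLap n s) := by
  have hadj : ∀ x y, (circulant n s).Adj x y ↔
      ∃ i, x - y = (s i : ZMod n) ∨ x - y = -(s i : ZMod n) := by
    intro x y
    simp only [circulant, SimpleGraph.circulantGraph_adj, Set.mem_ofPred_eq, ← exists_or]
    have h : ∀ i, (y - x = (s i : ZMod n) ↔ x - y = -(s i : ZMod n)) := fun i => by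
      rw [← neg_sub, neg_eq_iff_eq_neg]
    simp only [h, and_iff_right_iff_imp]
    rintro ⟨i, hi | hi⟩ rfl
    · rw [sub_self] at hi
      exact natCast_ne_zero_of_two_mul_lt (h1 i) (h2 i) hi.symm
    · rw [sub_self, zero_eq_neg] at hi
      exact natCast_ne_zero_of_two_mul_lt (h1 i) (h2 i) hi
  have hA : ∀ x y, (if (circulant n s).Adj x y then (1 : ℤ) else 0) =
      (if x = y then 2 * (k : ℤ) else 0) - circulantLap n s (x - y) := by
    intro x y
    rw [circulantLap, sum_indicator_eq hmono h1 h2]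
    simp only [hadj, sub_eq_zero, sub_sub_cancel]
  ext x y
  rw [SimpleGraph.lapMatrix, Matrix.sub_apply, SimpleGraph.adjMatrix_apply, SimpleGraph.degMatrix,
    Matrix.diagonal_apply, SimpleGraph.degree_eq_sum_if_adj, hA, Matrix.circulant_apply]
  have hd : ∑ y, (if (circulant n s).Adj x y then (1 : ℤ) else 0) = 2 * k := by
    simp only [hA, Finset.sum_sub_distrib]
    rw [Fintype.sum_equiv (Equiv.subLeft x) (fun y => circulantLap n s (x - y)) _ fun _ => rfl,
      sum_circulantLap]
    simp
  rw [hd]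
  ring

lemma det_circulantLap_add_one [NeZero n] {s : Fin k → ℕ} (hmono : StrictMono s)
    (h1 : ∀ j, 1 ≤ s j) (h2 : ∀ j, 2 * s j < n) :
    (Matrix.circulant fun z => circulantLap n s z + 1).det =
      (n : ℤ) ^ 2 * numSpanningTrees (circulant n s) := by
  have h := Matrix.det_add_one_of_sum_eq_zero (Matrix.circulant (circulantLap n s))
    (fun x => by
      rw [← sum_circulantLap (n := n) s]
      exact Fintype.sum_equiv (Equiv.subLeft x) _ _ fun _ => rfl)
    (fun y => by
      rw [← sum_circulantLap (n := n) s]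
      exact Fintype.sum_equiv (Equiv.subRight y) _ _ fun _ => rfl) 0
  rw [← lapMatrix_circulant hmono h1 h2, SimpleGraph.det_lapMatrix_updateRow, ZMod.card,
    lapMatrix_circulant hmono h1 h2] at h
  exact h

lemma stdAddChar_half (m : ℕ) :
    (ZMod.stdAddChar ((m + 1 : ℕ) : ZMod (2 * (m + 1))) : ℂ) = -1 := by
  have h1 := ZMod.stdAddChar_mul_half m 1
  rw [one_mul, AddChar.map_neg_eq_inv] at h1
  set w := (ZMod.stdAddChar ((m + 1 : ℕ) : ZMod (2 * (m + 1))) : ℂ) with hw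
  have hw0 : w ≠ 0 := by
    intro h
    have h2 := AddChar.map_add_eq_mul (ZMod.stdAddChar (N := 2 * (m + 1)))
      ((m + 1 : ℕ) : ZMod (2 * (m + 1))) (-((m + 1 : ℕ) : ZMod (2 * (m + 1))))
    rw [add_neg_cancel, AddChar.map_zero_eq_one, ← hw, h, zero_mul] at h2
    exact one_ne_zero h2
  have h3 : w * w = 1 := by
    nth_rewrite 1 [← h1]
    exact inv_mul_cancel₀ hw0
  refine (mul_self_eq_one_iff.1 h3).resolve_left fun h => ?_
  have h4 := ZMod.injective_stdAddChar (h.trans (AddChar.map_zero_eq_one _).symm)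
  rw [ZMod.natCast_eq_zero_iff] at h4
  have := Nat.le_of_dvd (by omega) h4
  omega

lemma circulantEigenvalue_circulantLap_half (m : ℕ) (s : Fin k → ℕ) :
    ZMod.circulantEigenvalue (fun z => (circulantLap (2 * (m + 1)) s z : ℂ))
      ((m + 1 : ℕ) : ZMod (2 * (m + 1))) = 4 * (univ.filter fun j => Odd (s j)).card := by
  have hpow : ∀ a : ℕ, (ZMod.stdAddChar ((a : ZMod (2 * (m + 1))) *
      ((m + 1 : ℕ) : ZMod (2 * (m + 1)))) : ℂ) = (-1) ^ a := fun a => by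
    rw [← nsmul_eq_mul, AddChar.map_nsmul_eq_pow, stdAddChar_half]
  have h : ZMod.circulantEigenvalue (fun z => (circulantLap (2 * (m + 1)) s z : ℂ))
      ((m + 1 : ℕ) : ZMod (2 * (m + 1))) = ∑ i : Fin k, (2 - 2 * (-1) ^ s i : ℂ) := by
    simp only [ZMod.circulantEigenvalue, circulantLap]
    simp only [Int.cast_sub, Int.cast_ite, Int.cast_mul, Int.cast_sum, Int.cast_add, Int.cast_one,
      Int.cast_zero, Int.cast_ofNat, Int.cast_natCast]
    simp only [sub_mul, Finset.sum_mul, Finset.sum_sub_distrib, add_mul]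
    rw [Finset.sum_comm]
    simp only [Finset.sum_add_distrib, ite_mul, zero_mul, one_mul, Finset.sum_ite_eq', mem_univ,
      if_true, neg_mul, ZMod.stdAddChar_mul_half, hpow, AddChar.map_zero_eq_one]
    rw [← Finset.mul_sum]
    simp
    ring
  rw [h, Finset.card_filter, Nat.cast_sum, Finset.mul_sum]
  refine Finset.sum_congr rfl fun i _ => ?_
  split_ifs with hi
  · rw [hi.neg_one_pow]
    norm_num
  · rw [(Nat.not_odd_iff_even.1 hi).neg_one_pow]
    norm_num

lemma card_mul_numSpanningTrees_circulant (m : ℕ) {s : Fin k → ℕ} (hmono : StrictMono s)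
    (h1 : ∀ j, 1 ≤ s j) (h2 : ∀ j, 2 * s j < 2 * (m + 1)) :
    ((2 * (m + 1) : ℕ) : ℤ) * numSpanningTrees (circulant (2 * (m + 1)) s) =
      4 * (univ.filter fun j => Odd (s j)).card *
        (ZMod.oddCirculant m (circulantLap (2 * (m + 1)) s)).det ^ 2 := by
  set n := 2 * (m + 1) with hn
  let c : ZMod n → ℂ := fun z => circulantLap n s z
  have hc : ∀ y, c (-y) = c y := fun y => congrArg Int.cast (circulantLap_neg s y)
  have hdet := congrArg (Int.cast : ℤ → ℂ) (det_circulantLap_add_one hmono h1 h2)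
  have hmap : ((Matrix.circulant fun z => circulantLap n s z + 1).det : ℂ) =
      (Matrix.circulant fun z => c z + 1).det := by
    rw [Int.cast_det]
    congr 1
    ext x y
    simp [Matrix.circulant_apply, c]
  have hodd : ((ZMod.oddCirculant m (circulantLap n s)).det : ℂ) = (ZMod.oddCirculant m c).det := by
    rw [Int.cast_det]
    congr 1
    ext x y
    simp [ZMod.oddCirculant, c]
  have heig : ∀ j, ZMod.circulantEigenvalue (fun z => c z + 1) j =
      ZMod.circulantEigenvalue c j + if j = 0 then (n : ℂ) else 0 := by
    intro j
    rw [← ZMod.sum_stdAddChar_mul j]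
    simp only [ZMod.circulantEigenvalue, add_mul, one_mul, Finset.sum_add_distrib]
  have hzero : ZMod.circulantEigenvalue c 0 = 0 := by
    simp only [ZMod.circulantEigenvalue, mul_zero, AddChar.map_zero_eq_one, mul_one, c]
    exact_mod_cast sum_circulantLap (n := n) s
  have hhalf : ((m + 1 : ℕ) : ZMod n) ≠ 0 := by
    intro h
    rw [ZMod.natCast_eq_zero_iff] at h
    have := Nat.le_of_dvd (by omega) h
    omega
  have hne : ∀ i : Fin m, ((i + 1 : ℕ) : ZMod n) ≠ 0 := fun i =>
    natCast_ne_zero_of_two_mul_lt (by omega) (by omega)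
  rw [hmap, ZMod.det_circulant, ZMod.prod_univ_eq_prod_half m] at hdet
  simp only [heig, hzero, neg_eq_zero, if_neg hhalf, if_neg (hne _), if_true, add_zero, zero_add,
    ZMod.circulantEigenvalue_neg hc, Finset.prod_mul_distrib] at hdet
  rw [← ZMod.det_oddCirculant m hc, ← hodd, circulantEigenvalue_circulantLap_half] at hdet
  have hn0 : (n : ℂ) ≠ 0 := Nat.cast_ne_zero.2 (by omega)
  have : (n : ℂ) * numSpanningTrees (circulant n s) =
      4 * (univ.filter fun j => Odd (s j)).card *
        ((ZMod.oddCirculant m (circulantLap n s)).det : ℂ) ^ 2 := by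
    refine mul_left_cancel₀ hn0 ?_
    simp only [Int.cast_mul, Int.cast_pow, Int.cast_natCast] at hdet
    linear_combination -hdet
  exact_mod_cast this

end Circulant

/-- for even `n`, if `p` is the number of odd elements among `s_1,…,s_k` and
`q` is the square-free part of `p` (i.e. `q` squarefree with `p = q r²`, `r ≥ 1`), then the
number of spanning trees of `C_n(s_1,…,s_k)` equals `q · n · a²` for some integer `a`. -/
theorem statement11 (n k : ℕ) (heven : Even n) (hn : 2 ≤ n) (hk : 0 < k) (s : Fin k → ℕ)
    (hmono : StrictMono s) (h1 : ∀ j, 1 ≤ s j) (h2 : ∀ j, 2 * s j < n)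
    (hgcd : Nat.gcd (Finset.univ.gcd s) n = 1)
    (q r : ℕ) (hq : Squarefree q) (hr : 0 < r)
    (hpqr : (Finset.univ.filter fun j => Odd (s j)).card = q * r ^ 2) :
    ∃ a : ℕ, numSpanningTrees (circulant n s) = q * n * a ^ 2 := by
  obtain ⟨m, rfl⟩ : ∃ m, n = 2 * (m + 1) := by
    obtain ⟨l, rfl⟩ := heven
    exact ⟨l - 1, by omega⟩
  have htrees := card_mul_numSpanningTrees_circulant m hmono h1 h2
  have hdvd : 2 * (m + 1) ∣ numSpanningTrees (circulant (2 * (m + 1)) s) := by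
    have := SimpleGraph.card_dvd_numSpanningTrees_circulantGraph
      {x : ZMod (2 * (m + 1)) | ∃ j : Fin k, x = (s j : ZMod (2 * (m + 1)))} <| by
        rintro _ ⟨j, rfl⟩ - h
        exact natCast_ne_neg_natCast (h1 j) (h2 j) (h2 j) (eq_neg_of_add_eq_zero_left h)
    rwa [Nat.card_zmod] at this
  obtain ⟨t, ht⟩ := hdvd
  rw [hpqr] at htrees
  set D := (ZMod.oddCirculant m (circulantLap (2 * (m + 1)) s)).det
  set n := 2 * (m + 1)
  have hnat : n ^ 2 * t = q * (2 * r * D.natAbs) ^ 2 := by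
    zify
    rw [mul_pow, sq_abs]
    rw [ht] at htrees
    push_cast at htrees ⊢
    linear_combination htrees
  have hsq : n ^ 2 * (q * t) = (q * (2 * r * D.natAbs)) ^ 2 := by
    linear_combination q * hnat
  obtain ⟨c, hc⟩ := (Nat.pow_dvd_pow_iff two_ne_zero).1 (Dvd.intro _ hsq)
  have hn0 : 0 < n ^ 2 := by positivity
  have hqt : q * t = c ^ 2 := by
    refine Nat.eq_of_mul_eq_mul_left hn0 ?_
    rw [hsq, hc, mul_pow]
  obtain ⟨a, rfl⟩ := (hq.dvd_pow_iff_dvd two_ne_zero).1 (Dvd.intro _ hqt)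
  refine ⟨a, ?_⟩
  have hta : t = q * a ^ 2 :=
    Nat.eq_of_mul_eq_mul_left (Nat.pos_of_ne_zero hq.ne_zero) (by rw [hqt]; ring)
  rw [ht, hta]
  ring
end
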